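/- For 1 ≤ r ≤ k, the noncommutative power sum has the cancellation-free expression in 𝒜_k: p_r = Σ_{i=0}^{r−1} (−1)^i Σ_{u ∈ V^r_{i,wc}} u + Σ_{i=1}^{r−1} (−1)^i (r−i) Σ_{u ∈ U^r_{i−1,wc}} u + Σ_{i=1}^{r−2} (−1)^i Σ_{u ∈ U^r_{i−1,w̄c,left}} u. -/

import Mathlib

open scoped BigOperators Classical

noncomputable section

namespace MN

/-! ## Residues, words, canonical cyclic intervals -/

/-- The residues `ℤ/(k+1)ℤ`. -/
abbrev Idx (k : ℕ) := ZMod (k + 1)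

/-- A word in the generators, recorded by its list of indices. -/
abbrev Word (k : ℕ) := List (Idx k)

/-- The support of a word. -/
def supp (k : ℕ) (u : Word k) : Finset (Idx k) := u.toFinset

/-- The smallest `a ∈ {0,…,k}` (as a natural number) with `(a : ℤ/(k+1)) ∉ S`. -/
def gapNat (k : ℕ) (S : Finset (Idx k)) : ℕ :=
  if h : ∃ m : ℕ, m ≤ k ∧ (m : Idx k) ∉ S then Nat.find h else 0

/-- The gap element `a` of a proper subset `S`. -/
def gap (k : ℕ) (S : Finset (Idx k)) : Idx k := (gapNat k S : Idx k)

/-- Position of a residue `i` in the canonical cyclic interval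
`I_S : a+1 < a+2 < ⋯ < k < 0 < ⋯ < a−1` (the gap `a` itself gets the junk position `k`). -/
def pos (k : ℕ) (S : Finset (Idx k)) (i : Idx k) : ℕ := (i - gap k S - 1).val

/-- The list of positions of the letters of `u` in the canonical cyclic interval of its support. -/
def posList (k : ℕ) (u : Word k) : List ℕ := u.map (pos k (supp k u))

/-- A weak hook word of hook type V:
`i₁ > ⋯ > i_j < i_{j+1} < ⋯ < i_m` with respect to `I_{supp u}`. -/
def IsHookV (k : ℕ) (u : Word k) : Prop :=
  supp k u ≠ Finset.univ ∧
    ∃ (ds as : List ℕ) (v : ℕ),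
      posList k u = ds ++ v :: as ∧
        List.Chain' (· > ·) (ds ++ [v]) ∧ List.Chain' (· < ·) (v :: as)

/-- A weak hook word of hook type U:
`i₁ > ⋯ > i_j = i_{j+1} < ⋯ < i_m` with respect to `I_{supp u}`. -/
def IsHookU (k : ℕ) (u : Word k) : Prop :=
  supp k u ≠ Finset.univ ∧
    ∃ (ds as : List ℕ) (v : ℕ),
      posList k u = ds ++ v :: v :: as ∧
        List.Chain' (· > ·) (ds ++ [v]) ∧ List.Chain' (· < ·) (v :: as)

/-- A weak hook word. -/
def IsWeakHook (k : ℕ) (u : Word k) : Prop := IsHookV k u ∨ IsHookU k u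

/-- The number of ascents `i_t < i_{t+1}` of a word. -/
def asc (k : ℕ) (u : Word k) : ℕ :=
  ((posList k u).zip (posList k u).tail).countP fun p => decide (p.1 < p.2)

/-- The candidates `c` in the definition of `u_min`: letters `c` of `u` for which there is a
letter `a` of `u` with `a < c` in `I_{supp u}`, `a + 1 ≠ c`, and no letter `b` of `u` satisfies
`a < b < c`. -/
def uminCands (k : ℕ) (u : Word k) : Finset (Idx k) :=
  (supp k u).filter fun c =>
    ∃ a ∈ supp k u,
      pos k (supp k u) a < pos k (supp k u) c ∧ a + 1 ≠ c ∧
        ∀ b ∈ supp k u,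
          ¬(pos k (supp k u) a < pos k (supp k u) b ∧
            pos k (supp k u) b < pos k (supp k u) c)

/-- The letter `u_min` of `u` (junk value `0` if there is no candidate). -/
def umin (k : ℕ) (u : Word k) : Idx k :=
  if h : (uminCands k u).Nonempty then
    ((uminCands k u).exists_min_image (pos k (supp k u)) h).choose
  else 0

/-- The number of occurrences of `u_min` in `u` (`0` if there is no candidate). -/
def uminCount (k : ℕ) (u : Word k) : ℕ :=
  if (uminCands k u).Nonempty then u.count (umin k u) else 0

/-- A set of residues is `k`-connected if it is a proper subset of `{0,…,k}` which is an
interval with respect to its canonical cyclic interval order. -/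
def IsKConnectedSet (k : ℕ) (S : Finset (Idx k)) : Prop :=
  S ≠ Finset.univ ∧
    ∀ i ∈ S, ∀ j ∈ S, ∀ m : Idx k,
      pos k S i ≤ pos k S m → pos k S m ≤ pos k S j → m ∈ S

/-- A word is `k`-connected if its support is. -/
def IsKConnected (k : ℕ) (u : Word k) : Prop := IsKConnectedSet k (supp k u)

/-- A word is `k`-weak connected if `u_min` occurs `0` or `2` times in it. -/
def IsWeakConnected (k : ℕ) (u : Word k) : Prop :=
  uminCount k u = 0 ∨ uminCount k u = 2

/-- The letter `c` lies on the left side (the maximal strictly decreasing initial segment) of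
the hook form of `u`: equivalently, it occurs in some strictly decreasing initial segment. -/
def OnLeftSide (k : ℕ) (u : Word k) (c : Idx k) : Prop :=
  ∃ p q : Word k, u = p ++ q ∧
    List.Chain' (fun a b => pos k (supp k u) b < pos k (supp k u) a) p ∧ c ∈ p

/-- The letter `c` lies on the right side (the maximal strictly increasing final segment) of
the hook form of `u`. -/
def OnRightSide (k : ℕ) (u : Word k) (c : Idx k) : Prop :=
  ∃ p q : Word k, u = p ++ q ∧
    List.Chain' (fun a b => pos k (supp k u) a < pos k (supp k u) b) q ∧ c ∈ q

/-! ## The sets `X^r_i` and their refinements (indexed by `i : ℤ`, empty for `i < 0`) -/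

/-- `V^r_i`: weak hook words of hook type V, weak length `r`, `asc = i`. -/
def VSet (k r : ℕ) (i : ℤ) : Set (Word k) :=
  {u | IsHookV k u ∧ u.length = r ∧ (asc k u : ℤ) = i}

/-- `U^r_i`. -/
def USet (k r : ℕ) (i : ℤ) : Set (Word k) :=
  {u | IsHookU k u ∧ u.length = r ∧ (asc k u : ℤ) = i}

/-- `V^r_{i,wc}`: the `k`-weak connected members of `V^r_i`. -/
def VSetWC (k r : ℕ) (i : ℤ) : Set (Word k) := {u ∈ VSet k r i | IsWeakConnected k u}

/-- `U^r_{i,wc}`. -/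
def USetWC (k r : ℕ) (i : ℤ) : Set (Word k) := {u ∈ USet k r i | IsWeakConnected k u}

/-- `V^r_{i,c}`: the `k`-connected members of `V^r_i`. -/
def VSetC (k r : ℕ) (i : ℤ) : Set (Word k) := {u ∈ VSet k r i | IsKConnected k u}

/-- `V^r_{i,w̄c,left}`. -/
def VSetNWCL (k r : ℕ) (i : ℤ) : Set (Word k) :=
  {u ∈ VSet k r i | ¬IsWeakConnected k u ∧ OnLeftSide k u (umin k u)}

/-- `V^r_{i,w̄c,right}`. -/
def VSetNWCR (k r : ℕ) (i : ℤ) : Set (Word k) :=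
  {u ∈ VSet k r i | ¬IsWeakConnected k u ∧ OnRightSide k u (umin k u)}

/-- `U^r_{i,w̄c,left}`. -/
def USetNWCL (k r : ℕ) (i : ℤ) : Set (Word k) :=
  {u ∈ USet k r i | ¬IsWeakConnected k u ∧ OnLeftSide k u (umin k u)}

/-- `U^r_{i,w̄c,right}`. -/
def USetNWCR (k r : ℕ) (i : ℤ) : Set (Word k) :=
  {u ∈ USet k r i | ¬IsWeakConnected k u ∧ OnRightSide k u (umin k u)}

/-! ## The algebras `𝒜_k`, `ℋ_k`, `𝒩_k` -/

/-- The defining relations of `𝒜_k`. -/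
inductive AkRel (k : ℕ) : FreeAlgebra ℤ (Idx k) → FreeAlgebra ℤ (Idx k) → Prop
  | braid (i : Idx k) :
      AkRel k (FreeAlgebra.ι ℤ i * FreeAlgebra.ι ℤ (i + 1) * FreeAlgebra.ι ℤ i)
        (FreeAlgebra.ι ℤ (i + 1) * FreeAlgebra.ι ℤ i * FreeAlgebra.ι ℤ (i + 1))
  | comm (i j : Idx k) (h1 : i - j ≠ 1) (h2 : j - i ≠ 1) :
      AkRel k (FreeAlgebra.ι ℤ i * FreeAlgebra.ι ℤ j)
        (FreeAlgebra.ι ℤ j * FreeAlgebra.ι ℤ i)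

/-- The algebra `𝒜_k`. -/
abbrev Ak (k : ℕ) := RingQuot (AkRel k)

/-- The generator `A_i` of `𝒜_k`. -/
def Agen (k : ℕ) (i : Idx k) : Ak k := RingQuot.mkAlgHom ℤ (AkRel k) (FreeAlgebra.ι ℤ i)

/-- The element `A_{i₁} ⋯ A_{i_m}` of `𝒜_k` associated to a word. -/
def Aword (k : ℕ) (u : Word k) : Ak k := (u.map (Agen k)).prod

/-- The defining relations of the 0-Hecke algebra `ℋ_k`. -/
inductive HkRel (k : ℕ) : FreeAlgebra ℤ (Idx k) → FreeAlgebra ℤ (Idx k) → Prop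
  | braid (i : Idx k) :
      HkRel k (FreeAlgebra.ι ℤ i * FreeAlgebra.ι ℤ (i + 1) * FreeAlgebra.ι ℤ i)
        (FreeAlgebra.ι ℤ (i + 1) * FreeAlgebra.ι ℤ i * FreeAlgebra.ι ℤ (i + 1))
  | comm (i j : Idx k) (h1 : i - j ≠ 1) (h2 : j - i ≠ 1) :
      HkRel k (FreeAlgebra.ι ℤ i * FreeAlgebra.ι ℤ j)
        (FreeAlgebra.ι ℤ j * FreeAlgebra.ι ℤ i)
  | sq (i : Idx k) :
      HkRel k (FreeAlgebra.ι ℤ i * FreeAlgebra.ι ℤ i) (-(FreeAlgebra.ι ℤ i))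

/-- The 0-Hecke algebra `ℋ_k`. -/
abbrev Hk (k : ℕ) := RingQuot (HkRel k)

/-- The generator `H_i`. -/
def Hgen (k : ℕ) (i : Idx k) : Hk k := RingQuot.mkAlgHom ℤ (HkRel k) (FreeAlgebra.ι ℤ i)

/-- The element `H_{i₁} ⋯ H_{i_m}`. -/
def Hword (k : ℕ) (u : Word k) : Hk k := (u.map (Hgen k)).prod

/-- The defining relations of the nilCoxeter algebra `𝒩_k`. -/
inductive NkRel (k : ℕ) : FreeAlgebra ℤ (Idx k) → FreeAlgebra ℤ (Idx k) → Prop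
  | braid (i : Idx k) :
      NkRel k (FreeAlgebra.ι ℤ i * FreeAlgebra.ι ℤ (i + 1) * FreeAlgebra.ι ℤ i)
        (FreeAlgebra.ι ℤ (i + 1) * FreeAlgebra.ι ℤ i * FreeAlgebra.ι ℤ (i + 1))
  | comm (i j : Idx k) (h1 : i - j ≠ 1) (h2 : j - i ≠ 1) :
      NkRel k (FreeAlgebra.ι ℤ i * FreeAlgebra.ι ℤ j)
        (FreeAlgebra.ι ℤ j * FreeAlgebra.ι ℤ i)
  | sq (i : Idx k) :
      NkRel k (FreeAlgebra.ι ℤ i * FreeAlgebra.ι ℤ i) 0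

/-- The nilCoxeter algebra `𝒩_k`. -/
abbrev Nk (k : ℕ) := RingQuot (NkRel k)

/-- The generator `N_i`. -/
def Ngen (k : ℕ) (i : Idx k) : Nk k := RingQuot.mkAlgHom ℤ (NkRel k) (FreeAlgebra.ι ℤ i)

/-- The element `N_{i₁} ⋯ N_{i_m}`. -/
def Nword (k : ℕ) (u : Word k) : Nk k := (u.map (Ngen k)).prod

/-! ## The affine symmetric group -/

/-- The relators of the affine symmetric group `S̃_{k+1}`. -/
def CoxRels (k : ℕ) : Set (FreeGroup (Idx k)) :=
  {g | (∃ i : Idx k, g = FreeGroup.of i * FreeGroup.of i) ∨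
    (∃ i : Idx k,
      g = FreeGroup.of i * FreeGroup.of (i + 1) * FreeGroup.of i *
        (FreeGroup.of (i + 1) * FreeGroup.of i * FreeGroup.of (i + 1))⁻¹) ∨
    (∃ i j : Idx k, i - j ≠ 1 ∧ j - i ≠ 1 ∧
      g = FreeGroup.of i * FreeGroup.of j * (FreeGroup.of j * FreeGroup.of i)⁻¹)}

/-- The affine symmetric group `S̃_{k+1}`. -/
abbrev AffS (k : ℕ) := PresentedGroup (CoxRels k)

/-- The generator `s_i`. -/
def sgen (k : ℕ) (i : Idx k) : AffS k := PresentedGroup.of i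

/-- The product `s_{i₁} ⋯ s_{i_m}`. -/
def sword (k : ℕ) (u : Word k) : AffS k := (u.map (sgen k)).prod

/-- The Coxeter length of `w ∈ S̃_{k+1}`. -/
def len (k : ℕ) (w : AffS k) : ℕ :=
  sInf {m | ∃ u : Word k, u.length = m ∧ sword k u = w}

/-- `u` is a reduced word. -/
def IsReducedWord (k : ℕ) (u : Word k) : Prop := len k (sword k u) = u.length

/-- The finite symmetric group `S_{k+1} = ⟨s_1, …, s_k⟩` inside `S̃_{k+1}`. -/
def FinSub (k : ℕ) : Subgroup (AffS k) :=
  Subgroup.closure {g | ∃ i : Idx k, i ≠ 0 ∧ g = sgen k i}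

/-- `w` is a minimal-length coset representative of `S̃_{k+1}/S_{k+1}` (a Grassmannian
element). -/
def IsGrassmannian (k : ℕ) (w : AffS k) : Prop :=
  ∀ v : AffS k, w⁻¹ * v ∈ FinSub k → len k w ≤ len k v

/-! ## Anti-weak hook words -/

/-- Anti-weak hook word, first form: `i₁ < ⋯ < i_j > i_{j+1} > ⋯ > i_m`. -/
def IsAntiHookV (k : ℕ) (u : Word k) : Prop :=
  supp k u ≠ Finset.univ ∧
    ∃ (ds as : List ℕ) (v : ℕ),
      posList k u = ds ++ v :: as ∧
        List.Chain' (· < ·) (ds ++ [v]) ∧ List.Chain' (· > ·) (v :: as)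

/-- Anti-weak hook word, second form: `i₁ < ⋯ < i_j = i_{j+1} > ⋯ > i_m`. -/
def IsAntiHookU (k : ℕ) (u : Word k) : Prop :=
  supp k u ≠ Finset.univ ∧
    ∃ (ds as : List ℕ) (v : ℕ),
      posList k u = ds ++ v :: v :: as ∧
        List.Chain' (· < ·) (ds ++ [v]) ∧ List.Chain' (· > ·) (v :: as)

/-- Anti-weak hook word. -/
def IsAntiWeakHook (k : ℕ) (u : Word k) : Prop := IsAntiHookV k u ∨ IsAntiHookU k u

/-- Length of the maximal strictly increasing (w.r.t. `I_{supp u}`) initial segment of `u`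
(= the left side of an anti-weak hook word). -/
def incPrefixLen (k : ℕ) (u : Word k) : ℕ :=
  sSup {n | n ≤ u.length ∧
    List.Chain' (fun a b => pos k (supp k u) a < pos k (supp k u) b) (u.take n)}

/-- Length of the maximal strictly increasing (w.r.t. `I_{supp u}`) final segment of `u`
(= the right side of a weak hook word). -/
def incSuffixLen (k : ℕ) (u : Word k) : ℕ :=
  sSup {n | n ≤ u.length ∧
    List.Chain' (fun a b => pos k (supp k u) a < pos k (supp k u) b)
      (u.drop (u.length - n))}

/-! ## Noncommutative symmetric functions in `𝒜_k` -/

/-- The word underlying the cyclically decreasing element `d_A` (letters of `A` in decreasing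
position order, so that `A_{i+1}` occurs before `A_i` whenever `i, i+1 ∈ A`). -/
def dwordOf (k : ℕ) (A : Finset (Idx k)) : Word k :=
  (((A.image (pos k A)).sort (· ≤ ·)).reverse).map fun n => gap k A + 1 + (n : Idx k)

/-- The word underlying the cyclically increasing element `i_A`. -/
def iwordOf (k : ℕ) (A : Finset (Idx k)) : Word k :=
  ((A.image (pos k A)).sort (· ≤ ·)).map fun n => gap k A + 1 + (n : Idx k)

/-- The noncommutative homogeneous symmetric function `h_r = Σ_{|A| = r} d_A`. -/
def hFun (k r : ℕ) : Ak k :=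
  ∑ A ∈ Finset.powersetCard r (Finset.univ : Finset (Idx k)), Aword k (dwordOf k A)

/-- The noncommutative elementary symmetric function `e_r = Σ_{|A| = r} i_A`. -/
def eFun (k r : ℕ) : Ak k :=
  ∑ A ∈ Finset.powersetCard r (Finset.univ : Finset (Idx k)), Aword k (iwordOf k A)

/-- The noncommutative hook Schur function `s_{(r−i,1^i)}`. -/
def sHookFun (k r i : ℕ) : Ak k :=
  ∑ j ∈ Finset.range (i + 1), ((-1 : ℤ) ^ j) • (hFun k (r - i + j) * eFun k (i - j))

/-- The noncommutative power sum `p_r`. -/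
def pFun (k r : ℕ) : Ak k :=
  ∑ i ∈ Finset.range r, ((-1 : ℤ) ^ i) • sHookFun k r i

/-! ## Actions on the affine symmetric group -/

/-- The star action of a generator: `A_i * w = s_i w` if `l(s_i w) > l(w)`, else `w`. -/
def starG (k : ℕ) (i : Idx k) (w : AffS k) : AffS k :=
  if len k w < len k (sgen k i * w) then sgen k i * w else w

/-- The star action of a word: `A_{i₁}⋯A_{i_m} * w = A_{i₁} * (⋯ * (A_{i_m} * w))`. -/
def starW (k : ℕ) (u : Word k) (w : AffS k) : AffS k := u.foldr (starG k) w

/-- The dot action of a generator, with values in `S̃_{k+1} ∪ {0}`. -/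
def dotG (k : ℕ) (i : Idx k) : Option (AffS k) → Option (AffS k)
  | none => none
  | some w => if len k w < len k (sgen k i * w) then some (sgen k i * w) else none

/-- The dot action of a word. -/
def dotW (k : ℕ) (u : Word k) (o : Option (AffS k)) : Option (AffS k) :=
  u.foldr (dotG k) o

/-- Extension of an action datum `act : generator → S̃ → S̃ ∪ {0}` to `S̃ ∪ {0}`. -/
def actExt (k : ℕ) (act : Idx k → AffS k → Option (AffS k)) (i : Idx k) :
    Option (AffS k) → Option (AffS k)
  | none => none
  | some w => act i w

/-- Extension of an action datum to words. -/
def actW (k : ℕ) (act : Idx k → AffS k → Option (AffS k)) (u : Word k)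
    (o : Option (AffS k)) : Option (AffS k) :=
  u.foldr (actExt k act) o

/-! ## Rings and coefficients -/

/-- `(−1)^n` for an integer exponent `n`, in any ring. -/
def msign (R : Type*) [Ring R] (n : ℤ) : R := (((-1 : Rˣ) ^ n : Rˣ) : R)

/-- The power sum `p^R_r = Σ_{i=0}^{r−1} Σ_{j=0}^{i} (−1)^{i+j} h^R_{r−i+j} e^R_{i−j}` built from
Pieri data in a commutative ring. -/
def pR {R : Type*} [CommRing R] (h e : ℕ → R) (r : ℕ) : R :=
  ∑ i ∈ Finset.range r, ∑ j ∈ Finset.range (i + 1),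
    ((-1 : ℤ) ^ (i + j)) • (h (r - i + j) * e (i - j))

/-- The integer coefficient
`Σ_{i=0}^{r−1} (−1)^i |V^r_{i,wc} ∩ P| + Σ_{i=1}^{r−1} (−1)^i (r−i) |U^r_{i−1,wc} ∩ P|
 + Σ_{i=1}^{r−2} (−1)^i |U^r_{i−1,w̄c,left} ∩ P|`. -/
def MNcoeff (k r : ℕ) (P : Word k → Prop) : ℤ :=
  (∑ i ∈ Finset.range r, (-1 : ℤ) ^ i * ({u ∈ VSetWC k r (i : ℤ) | P u}.ncard : ℤ)) +
    (∑ i ∈ Finset.Icc 1 (r - 1),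
      (-1 : ℤ) ^ i * ((r : ℤ) - i) * ({u ∈ USetWC k r ((i : ℤ) - 1) | P u}.ncard : ℤ)) +
    ∑ i ∈ Finset.Icc 1 (r - 2),
      (-1 : ℤ) ^ i * ({u ∈ USetNWCL k r ((i : ℤ) - 1) | P u}.ncard : ℤ)

/-- The integer coefficient `Σ_{i=0}^{r−1} (−1)^i |V^r_{i,c} ∩ P|`. -/
def kcoeff (k r : ℕ) (P : Word k → Prop) : ℤ :=
  ∑ i ∈ Finset.range r, (-1 : ℤ) ^ i * ({u ∈ VSetC k r (i : ℤ) | P u}.ncard : ℤ)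

/-! ## Partitions, cores, bounded partitions -/

/-- A cell of a Young diagram: (row, column), `0`-indexed. -/
abbrev Cell := ℕ × ℕ

/-- A (finite) Young diagram, as a finite lower set of cells. -/
def IsYoung (S : Set Cell) : Prop :=
  S.Finite ∧ ∀ p ∈ S, ∀ q : Cell, q.1 ≤ p.1 → q.2 ≤ p.2 → q ∈ S

/-- The `(k+1)`-residue of a cell `(i,j)`, i.e. `j − i mod (k+1)`. -/
def res (k : ℕ) (c : Cell) : Idx k := (c.2 : Idx k) - (c.1 : Idx k)

/-- The hook length of a cell: arm + leg + 1. -/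
def hookLen (S : Set Cell) (c : Cell) : ℕ :=
  {j | c.2 < j ∧ (c.1, j) ∈ S}.ncard + {i | c.1 < i ∧ (i, c.2) ∈ S}.ncard + 1

/-- A `(k+1)`-core: a partition with no cell of hook length `k+1`. -/
def IsCore (k : ℕ) (S : Set Cell) : Prop :=
  IsYoung S ∧ ∀ c ∈ S, hookLen S c ≠ k + 1

/-- A `k`-bounded partition: every part is at most `k`. -/
def IsBounded (k : ℕ) (S : Set Cell) : Prop :=
  IsYoung S ∧ ∀ c ∈ S, c.2 < k

/-- A removable corner of `S`. -/
def Removable (S : Set Cell) (c : Cell) : Prop :=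
  c ∈ S ∧ (c.1 + 1, c.2) ∉ S ∧ (c.1, c.2 + 1) ∉ S

/-- An addable corner of `S`: a cell not in `S` whose addition yields a partition. -/
def Addable (S : Set Cell) (c : Cell) : Prop :=
  c ∉ S ∧ IsYoung (S ∪ {c})

/-- The map `𝔭` from `(k+1)`-cores to `k`-bounded partitions: row `i` of `𝔭(κ)` has as many
cells as there are cells of hook length at most `k` in row `i` of `κ`. -/
def pMap (k : ℕ) (S : Set Cell) : Set Cell :=
  {c | c.2 < {j | (c.1, j) ∈ S ∧ hookLen S (c.1, j) ≤ k}.ncard}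

/-- The inverse bijection `𝔭^{-1}` from `k`-bounded partitions to `(k+1)`-cores. -/
def pInv (k : ℕ) (lam : Set Cell) : Set Cell :=
  Function.invFunOn (pMap k) {S | IsCore k S} lam

/-- The transpose (conjugate) of a diagram. -/
def transposeSet (S : Set Cell) : Set Cell := {c | (c.2, c.1) ∈ S}

/-- The `k`-conjugate `λ^{(k)} = 𝔭((𝔭^{-1} λ)^t)`. -/
def kconj (k : ℕ) (lam : Set Cell) : Set Cell := pMap k (transposeSet (pInv k lam))

/-- A skew shape is a ribbon if it contains no `2×2` square. -/
def IsRibbon (D : Set Cell) : Prop :=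
  ∀ c : Cell, ¬((c.1, c.2) ∈ D ∧ (c.1 + 1, c.2) ∈ D ∧
    (c.1, c.2 + 1) ∈ D ∧ (c.1 + 1, c.2 + 1) ∈ D)

/-- A vertical strip: no two cells in the same row. -/
def IsVStrip (D : Set Cell) : Prop :=
  ∀ c ∈ D, ∀ c' ∈ D, c.1 = c'.1 → c = c'

/-- A horizontal strip: no two cells in the same column. -/
def IsHStrip (D : Set Cell) : Prop :=
  ∀ c ∈ D, ∀ c' ∈ D, c.2 = c'.2 → c = c'

/-- The height of a skew shape: the number of occupied rows minus the number of connected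
components; each connected component is counted by its unique last occupied row, i.e. an
occupied row sharing no column with the next row. -/
def htSkew (D : Set Cell) : ℕ :=
  {i : ℕ | ∃ j, (i, j) ∈ D}.ncard -
    {i : ℕ | (∃ j, (i, j) ∈ D) ∧ ¬∃ j, (i, j) ∈ D ∧ (i + 1, j) ∈ D}.ncard

/-- The set of `(k+1)`-residues of the cells of a skew shape. -/
def residSupp (k : ℕ) (D : Set Cell) : Finset (Idx k) :=
  Set.Finite.toFinset (Set.toFinite (res k '' D))

/-! ## Star and dot actions on cores and on `k`-bounded partitions -/

/-- The star action of `A_i` on `(k+1)`-cores together with `0`. -/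
def starC (k : ℕ) (i : Idx k) : Option (Set Cell) → Option (Set Cell)
  | none => none
  | some S =>
    if ∃ c, Addable S c ∧ res k c = i then some (S ∪ {c | Addable S c ∧ res k c = i})
    else if ∃ c, Removable S c ∧ res k c = i then some S
    else none

/-- The star action of a word on cores. -/
def starCW (k : ℕ) (u : Word k) (o : Option (Set Cell)) : Option (Set Cell) :=
  u.foldr (starC k) o

/-- The star action of a word on `k`-bounded partitions, transported through `𝔭`. -/
def starB (k : ℕ) (u : Word k) (lam : Set Cell) : Option (Set Cell) :=
  (starCW k u (some (pInv k lam))).map (pMap k)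

/-- The dot action of `A_i` on `(k+1)`-cores together with `0`. -/
def dotC (k : ℕ) (i : Idx k) : Option (Set Cell) → Option (Set Cell)
  | none => none
  | some S =>
    if ∃ c, Addable S c ∧ res k c = i then some (S ∪ {c | Addable S c ∧ res k c = i})
    else none

/-- The dot action of a word on cores. -/
def dotCW (k : ℕ) (u : Word k) (o : Option (Set Cell)) : Option (Set Cell) :=
  u.foldr (dotC k) o

/-- The dot action of a word on `k`-bounded partitions, transported through `𝔭`. -/
def dotB (k : ℕ) (u : Word k) (lam : Set Cell) : Option (Set Cell) :=
  (dotCW k u (some (pInv k lam))).map (pMap k)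

/-- The number of maximal segments of consecutive letters (w.r.t. the positions for `S`) of a
word `V`. -/
def numSegments (k : ℕ) (S : Finset (Idx k)) (V : Word k) : ℕ :=
  if V.length = 0 then 0
  else ((V.zip V.tail).countP fun p => decide (pos k S p.2 ≠ pos k S p.1 + 1)) + 1

/-- Conditions (K0)–(K4) of the Murnaghan–Nakayama rule for `K`-`k`-Schur functions. -/
def Kconds (k r : ℕ) (lam mu : Set Cell) : Prop :=
  lam ⊆ mu ∧ kconj k lam ⊆ kconj k mu ∧
    (mu \ lam).ncard ≤ r ∧
    IsRibbon (pInv k mu \ pInv k lam) ∧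
    (IsKConnectedSet k (residSupp k (pInv k mu \ pInv k lam)) ∨
      (residSupp k (pInv k mu \ pInv k lam)).card < r) ∧
    htSkew (mu \ lam) + htSkew (kconj k mu \ kconj k lam) < r

/-- Conditions (k0)–(k4) of the Murnaghan–Nakayama rule for `k`-Schur functions. -/
def kconds (k r : ℕ) (lam mu : Set Cell) : Prop :=
  lam ⊆ mu ∧ kconj k lam ⊆ kconj k mu ∧
    (mu \ lam).ncard = r ∧
    IsRibbon (pInv k mu \ pInv k lam) ∧
    IsKConnectedSet k (residSupp k (pInv k mu \ pInv k lam)) ∧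
    htSkew (mu \ lam) + htSkew (kconj k mu \ kconj k lam) = r - 1


/-! ## Auxiliary material for the proof -/

/-- Letters of `A` in increasing position with respect to `S`. -/
def srt (k : ℕ) (S A : Finset (Idx k)) : Word k :=
  ((A.image (pos k S)).sort (· ≤ ·)).map fun n : ℕ => gap k S + 1 + (n : Idx k)

lemma gap_add_pos (k : ℕ) (S : Finset (Idx k)) (i : Idx k) :
    gap k S + 1 + ((pos k S i : ℕ) : Idx k) = i := by
  unfold pos
  rw [ZMod.natCast_zmod_val]
  ring

lemma pos_inj (k : ℕ) (S : Finset (Idx k)) : Function.Injective (pos k S) := by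
  intro i j h
  rw [← gap_add_pos k S i, h, gap_add_pos]

lemma gap_not_mem (k : ℕ) (S : Finset (Idx k)) (hS : S ≠ Finset.univ) : gap k S ∉ S := by
  have h : ∃ m : ℕ, m ≤ k ∧ (m : Idx k) ∉ S := by
    by_contra hc
    push Not at hc
    apply hS
    ext x
    simp only [Finset.mem_univ, iff_true]
    have := hc x.val (Nat.lt_succ_iff.mp (ZMod.val_lt x))
    rwa [ZMod.natCast_zmod_val] at this
  unfold gap gapNat
  rw [dif_pos h]
  exact (Nat.find_spec h).2

lemma pos_pred (k : ℕ) (S : Finset (Idx k)) (hS : S ≠ Finset.univ) (i : Idx k)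
    (hi : i - 1 ∈ S) : pos k S (i - 1) + 1 = pos k S i := by
  have hg : i - 1 ≠ gap k S := fun h => gap_not_mem k S hS (h ▸ hi)
  unfold pos
  have hx : i - gap k S - 1 ≠ 0 := by
    intro h
    apply hg
    have : i - 1 - gap k S = 0 := by rw [← h]; ring
    exact sub_eq_zero.mp this
  have e : i - 1 - gap k S - 1 = (i - gap k S - 1) - 1 := by ring
  rw [e]
  generalize i - gap k S - 1 = x at hx
  have hpos : 0 < x.val := by
    rcases Nat.eq_zero_or_pos x.val with h | h
    · exact absurd ((ZMod.val_eq_zero x).mp h) hx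
    · exact h
  have hlt := ZMod.val_lt x
  have : x - 1 = ((x.val - 1 : ℕ) : ZMod (k + 1)) := by
    rw [Nat.cast_sub hpos, ZMod.natCast_zmod_val, Nat.cast_one]
  rw [this, ZMod.val_natCast_of_lt (by omega)]
  omega

lemma srt_map_pos (k : ℕ) (S A : Finset (Idx k)) :
    (srt k S A).map (pos k S) = (A.image (pos k S)).sort (· ≤ ·) := by
  unfold srt
  rw [List.map_map]
  conv_rhs => rw [← List.map_id ((A.image (pos k S)).sort (· ≤ ·))]
  apply List.map_congr_left
  intro n hn
  rw [Finset.mem_sort, Finset.mem_image] at hn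
  obtain ⟨i, -, rfl⟩ := hn
  simp [gap_add_pos]

lemma mem_srt (k : ℕ) (S A : Finset (Idx k)) (x : Idx k) : x ∈ srt k S A ↔ x ∈ A := by
  have : x ∈ srt k S A ↔ pos k S x ∈ (srt k S A).map (pos k S) := by
    rw [List.mem_map_of_injective (pos_inj k S)]
  rw [this, srt_map_pos, Finset.mem_sort, Finset.mem_image]
  constructor
  · rintro ⟨y, hy, h⟩
    rwa [← pos_inj k S h]
  · intro h
    exact ⟨x, h, rfl⟩

lemma srt_pw (k : ℕ) (S A : Finset (Idx k)) :
    (srt k S A).Pairwise (fun x y => pos k S x < pos k S y) := by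
  rw [← List.pairwise_map (f := pos k S) (R := (· < ·)), srt_map_pos]
  exact (Finset.sortedLT_sort _).pairwise

lemma srt_nodup (k : ℕ) (S A : Finset (Idx k)) : (srt k S A).Nodup :=
  (srt_pw k S A).imp (fun h e => by subst e; exact lt_irrefl _ h)

lemma srt_length (k : ℕ) (S A : Finset (Idx k)) : (srt k S A).length = A.card := by
  rw [← List.toFinset_card_of_nodup (srt_nodup k S A)]
  congr 1
  ext x
  simp [mem_srt]

lemma srt_unique (k : ℕ) (S A : Finset (Idx k)) (l : Word k)
    (h : l.Pairwise (fun x y => pos k S x < pos k S y)) (hm : ∀ x, x ∈ l ↔ x ∈ A) :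
    l = srt k S A := by
  have hn : l.Nodup := h.imp (fun h e => by subst e; exact lt_irrefl _ h)
  have hp : l.Perm (srt k S A) := by
    rw [List.perm_ext_iff_of_nodup hn (srt_nodup k S A)]
    intro x
    rw [hm, mem_srt]
  exact hp.eq_of_pairwise (fun a b _ _ h1 h2 => absurd (lt_trans h1 h2) (lt_irrefl _)) h
    (srt_pw k S A)

lemma Agen_comm (k : ℕ) (i j : Idx k) (h1 : j ≠ i + 1) (h2 : i ≠ j + 1) :
    Agen k i * Agen k j = Agen k j * Agen k i := by
  unfold Agen
  rw [← map_mul, ← map_mul]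
  apply RingQuot.mkAlgHom_rel
  apply AkRel.comm
  · intro h; exact h2 (by rw [← h]; ring)
  · intro h; exact h1 (by rw [← h]; ring)

lemma Aword_append (k : ℕ) (u v : Word k) : Aword k (u ++ v) = Aword k u * Aword k v := by
  simp [Aword]

lemma Aword_cons (k : ℕ) (x : Idx k) (v : Word k) : Aword k (x :: v) = Agen k x * Aword k v := by
  simp [Aword]

lemma Aword_comm (k : ℕ) (x : Idx k) (p : Word k)
    (h : ∀ y ∈ p, Agen k y * Agen k x = Agen k x * Agen k y) :
    Aword k p * Agen k x = Agen k x * Aword k p := by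
  induction p with
  | nil => simp [Aword]
  | cons y t ih =>
    rw [Aword_cons, mul_assoc, ih (fun z hz => h z (List.mem_cons_of_mem _ hz)), ← mul_assoc,
      h y (List.mem_cons_self), mul_assoc]

lemma trace_lemma (k : ℕ) (R : Idx k → Idx k → Prop)
    (hR : ∀ x y, R x y → R y x → Agen k x * Agen k y = Agen k y * Agen k x) :
    ∀ (l1 l2 : Word k), l1.Perm l2 → l1.Pairwise R → l2.Pairwise R → Aword k l1 = Aword k l2 := by
  intro l1
  induction l1 with
  | nil => intro l2 hp _ _; rw [List.nil_perm.mp hp]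
  | cons x t ih =>
    intro l2 hp h1 h2
    obtain ⟨p, q, rfl⟩ := List.append_of_mem (hp.subset (List.mem_cons_self (a := x) (l := t)))
    have hp' : t.Perm (p ++ q) := by
      have := hp.trans List.perm_middle
      exact (List.perm_cons x).mp this
    rw [List.pairwise_cons] at h1
    rw [List.pairwise_append, List.pairwise_cons] at h2
    obtain ⟨hpp, ⟨hxq, hq⟩, hpq⟩ := h2
    have hcomm := Aword_comm k x p (fun y hy => by
      apply hR
      · exact hpq y hy x (List.mem_cons_self)
      · exact h1.1 y (hp'.symm.subset (List.mem_append_left _ hy)))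
    rw [Aword_cons, ih (p ++ q) hp' h1.2, Aword_append, Aword_append, Aword_cons, ← mul_assoc,
      ← mul_assoc, hcomm]
    rw [List.pairwise_append]
    exact ⟨hpp, hq, fun a ha b hb => hpq a ha b (List.mem_cons_of_mem _ hb)⟩

lemma srt_pw_inc (k : ℕ) (S A : Finset (Idx k)) (hS : S ≠ Finset.univ) (hA : A ⊆ S) :
    (srt k S A).Pairwise (fun x y => x ≠ y + 1) := by
  refine List.Pairwise.imp_of_mem ?_ (srt_pw k S A)
  intro x y hx hy h e
  subst e
  have := pos_pred k S hS (y + 1) (by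
    rw [add_sub_cancel_right]; exact hA ((mem_srt _ _ _ _).mp hy))
  rw [add_sub_cancel_right] at this
  omega

lemma srt_pw_dec (k : ℕ) (S A : Finset (Idx k)) (hS : S ≠ Finset.univ) (hA : A ⊆ S) :
    (srt k S A).reverse.Pairwise (fun x y => y ≠ x + 1) :=
  List.pairwise_reverse.mpr (srt_pw_inc k S A hS hA)

lemma trace_inc (k : ℕ) (l1 l2 : Word k) (hp : l1.Perm l2)
    (h1 : l1.Pairwise (fun x y => x ≠ y + 1)) (h2 : l2.Pairwise (fun x y => x ≠ y + 1)) :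
    Aword k l1 = Aword k l2 :=
  trace_lemma k _ (fun x y h h' => Agen_comm k x y h' h) l1 l2 hp h1 h2

lemma trace_dec (k : ℕ) (l1 l2 : Word k) (hp : l1.Perm l2)
    (h1 : l1.Pairwise (fun x y => y ≠ x + 1)) (h2 : l2.Pairwise (fun x y => y ≠ x + 1)) :
    Aword k l1 = Aword k l2 :=
  trace_lemma k _ (fun x y h h' => Agen_comm k x y h h') l1 l2 hp h1 h2

lemma iword_eq (k : ℕ) (A : Finset (Idx k)) : iwordOf k A = srt k A A := by
  unfold iwordOf srt
  simp [List.map_eq_flatMap, List.flatMap_assoc]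

lemma dword_eq (k : ℕ) (A : Finset (Idx k)) : dwordOf k A = (srt k A A).reverse := by
  unfold dwordOf srt
  rw [← List.map_reverse]
  simp [List.map_eq_flatMap, List.flatMap_assoc]

lemma srt_perm (k : ℕ) (S S' A : Finset (Idx k)) : (srt k S A).Perm (srt k S' A) := by
  rw [List.perm_ext_iff_of_nodup (srt_nodup _ _ _) (srt_nodup _ _ _)]
  intro x
  rw [mem_srt, mem_srt]

lemma ne_univ_of_subset {k : ℕ} {S A : Finset (Idx k)} (hS : S ≠ Finset.univ) (hA : A ⊆ S) :
    A ≠ Finset.univ := by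
  rintro rfl
  exact hS (Finset.univ_subset_iff.mp hA)

lemma Aword_srt_inc (k : ℕ) (S A : Finset (Idx k)) (hS : S ≠ Finset.univ) (hA : A ⊆ S) :
    Aword k (srt k S A) = Aword k (iwordOf k A) := by
  rw [iword_eq]
  exact trace_inc k _ _ (srt_perm k S A A) (srt_pw_inc k S A hS hA)
    (srt_pw_inc k A A (ne_univ_of_subset hS hA) (Finset.Subset.refl _))

lemma Aword_srt_dec (k : ℕ) (S A : Finset (Idx k)) (hS : S ≠ Finset.univ) (hA : A ⊆ S) :
    Aword k (srt k S A).reverse = Aword k (dwordOf k A) := by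
  rw [dword_eq]
  exact trace_dec k _ _ ((List.reverse_perm _).trans
      ((srt_perm k S A A).trans (List.reverse_perm _).symm)) (srt_pw_dec k S A hS hA)
    (srt_pw_dec k A A (ne_univ_of_subset hS hA) (Finset.Subset.refl _))

lemma dword_erase (k : ℕ) (A : Finset (Idx k)) (hA : A ≠ Finset.univ) (c : Idx k) (hc : c ∈ A)
    (hc' : c - 1 ∉ A) :
    Aword k (dwordOf k A) = Aword k (dwordOf k (A.erase c)) * Agen k c := by
  have hs : A.erase c ⊆ A := Finset.erase_subset _ _
  have e : Agen k c = Aword k [c] := by simp [Aword]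
  rw [e, ← Aword_append, dword_eq, dword_eq]
  apply trace_dec
  · refine (List.perm_ext_iff_of_nodup ?_ ?_).mpr ?_
    · exact List.nodup_reverse.mpr (srt_nodup _ _ _)
    · rw [List.nodup_append]
      refine ⟨List.nodup_reverse.mpr (srt_nodup _ _ _), List.nodup_singleton _, ?_⟩
      intro a ha b hb
      rw [List.mem_reverse, mem_srt, Finset.mem_erase] at ha
      rw [List.mem_singleton] at hb
      rw [hb]; exact ha.1
    · intro x
      rw [List.mem_append, List.mem_reverse, List.mem_reverse, mem_srt, mem_srt,
        Finset.mem_erase, List.mem_singleton]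
      by_cases h : x = c
      · simp [h, hc]
      · simp [h]
  · exact srt_pw_dec k A A hA (Finset.Subset.refl _)
  · rw [List.pairwise_append]
    refine ⟨srt_pw_dec k _ _ (ne_univ_of_subset hA hs) (Finset.Subset.refl _),
      List.pairwise_singleton _ _, ?_⟩
    intro a ha b hb
    rw [List.mem_reverse, mem_srt, Finset.mem_erase] at ha
    rw [List.mem_singleton] at hb
    subst hb
    intro h
    apply hc'
    rw [h, add_sub_cancel_right]
    exact ha.2

lemma iword_insert (k : ℕ) (B : Finset (Idx k)) (c : Idx k) (hc : c ∉ B)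
    (hB : insert c B ≠ Finset.univ) (hc' : c - 1 ∉ B) :
    Aword k (iwordOf k (insert c B)) = Agen k c * Aword k (iwordOf k B) := by
  have hs : B ⊆ insert c B := Finset.subset_insert _ _
  rw [← Aword_cons, iword_eq, iword_eq]
  apply trace_inc
  · refine (List.perm_ext_iff_of_nodup (srt_nodup _ _ _) ?_).mpr ?_
    · rw [List.nodup_cons, mem_srt]
      exact ⟨hc, srt_nodup _ _ _⟩
    · intro x
      rw [List.mem_cons, mem_srt, mem_srt, Finset.mem_insert]
  · exact srt_pw_inc k _ _ hB (Finset.Subset.refl _)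
  · rw [List.pairwise_cons]
    refine ⟨?_, srt_pw_inc k _ _ (ne_univ_of_subset hB hs) (Finset.Subset.refl _)⟩
    intro b hb h
    rw [mem_srt] at hb
    apply hc'
    rw [h, add_sub_cancel_right]
    exact hb

/-- The value of a pair of sets. -/
def Tv (k : ℕ) (p : Finset (Idx k) × Finset (Idx k)) : Ak k :=
  Aword k (dwordOf k p.1) * Aword k (iwordOf k p.2)

lemma Tv_move (k : ℕ) (A B : Finset (Idx k)) (hS : A ∪ B ≠ Finset.univ) (c : Idx k)
    (hA : c ∈ A) (hB : c ∉ B) (hc : c - 1 ∉ A ∪ B) :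
    Tv k (A, B) = Tv k (A.erase c, insert c B) := by
  rw [Finset.mem_union, not_or] at hc
  unfold Tv
  rw [dword_erase k A (ne_univ_of_subset hS Finset.subset_union_left) c hA hc.1,
    iword_insert k B c hB (ne_univ_of_subset hS ?_) hc.2, mul_assoc]
  intro x hx
  rw [Finset.mem_insert] at hx
  rw [Finset.mem_union]
  rcases hx with rfl | h
  · exact Or.inl hA
  · exact Or.inr h

/-- The letter of `S` with minimal position. -/
def mn (k : ℕ) (S : Finset (Idx k)) : Idx k :=
  if h : S.Nonempty then (S.exists_min_image (pos k S) h).choose else 0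

lemma mn_mem (k : ℕ) (S : Finset (Idx k)) (h : S.Nonempty) : mn k S ∈ S := by
  unfold mn
  rw [dif_pos h]
  exact (S.exists_min_image (pos k S) h).choose_spec.1

lemma mn_le (k : ℕ) (S : Finset (Idx k)) (x : Idx k) (hx : x ∈ S) :
    pos k S (mn k S) ≤ pos k S x := by
  have h : S.Nonempty := ⟨x, hx⟩
  unfold mn
  rw [dif_pos h]
  exact (S.exists_min_image (pos k S) h).choose_spec.2 x hx

lemma mn_eq (k : ℕ) (S : Finset (Idx k)) (x : Idx k) (hx : x ∈ S)
    (h : ∀ y ∈ S, pos k S x ≤ pos k S y) : mn k S = x :=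
  pos_inj k S (le_antisymm (mn_le k S x hx) (h _ (mn_mem k S ⟨x, hx⟩)))

lemma mn_pred (k : ℕ) (S : Finset (Idx k)) (hS : S ≠ Finset.univ) : mn k S - 1 ∉ S := by
  intro h
  have h1 := pos_pred k S hS _ h
  have h2 := mn_le k S _ h
  omega

/-- Candidates, depending on the support only. -/
def candS (k : ℕ) (S : Finset (Idx k)) : Finset (Idx k) :=
  S.filter fun c =>
    ∃ a ∈ S,
      pos k S a < pos k S c ∧ a + 1 ≠ c ∧
        ∀ b ∈ S,
          ¬(pos k S a < pos k S b ∧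
            pos k S b < pos k S c)

/-- `u_min`, depending on the support only. -/
def uminS (k : ℕ) (S : Finset (Idx k)) : Idx k :=
  if h : (candS k S).Nonempty then
    ((candS k S).exists_min_image (pos k S) h).choose
  else 0

lemma cands_eq (k : ℕ) (u : Word k) : uminCands k u = candS k (supp k u) := rfl

lemma umin_eq (k : ℕ) (u : Word k) : umin k u = uminS k (supp k u) := rfl

lemma uminS_cand (k : ℕ) (S : Finset (Idx k)) (h : (candS k S).Nonempty) :
    uminS k S ∈ candS k S := by
  unfold uminS
  rw [dif_pos h]
  exact ((candS k S).exists_min_image (pos k S) h).choose_spec.1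

lemma uminS_mem (k : ℕ) (S : Finset (Idx k)) (h : (candS k S).Nonempty) :
    uminS k S ∈ S := (Finset.mem_filter.mp (uminS_cand k S h)).1

lemma uminS_ne (k : ℕ) (S : Finset (Idx k)) (h : (candS k S).Nonempty) :
    uminS k S ≠ mn k S := by
  intro e
  obtain ⟨a, ha, h1, -⟩ := (Finset.mem_filter.mp (uminS_cand k S h)).2
  have := mn_le k S a ha
  rw [e] at h1
  omega

lemma uminS_pred (k : ℕ) (S : Finset (Idx k)) (hS : S ≠ Finset.univ) (h : (candS k S).Nonempty) :
    uminS k S - 1 ∉ S := by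
  intro hm
  obtain ⟨a, ha, h1, h2, h3⟩ := (Finset.mem_filter.mp (uminS_cand k S h)).2
  have h4 := pos_pred k S hS _ hm
  apply h3 _ hm
  refine ⟨?_, by omega⟩
  have hne : pos k S a ≠ pos k S (uminS k S - 1) := by
    intro e
    apply h2
    rw [pos_inj k S e]
    ring
  omega

/-- Pairs of sets with total size `r`, second set of size `b`, satisfying `Q`. -/
def PS (k r b : ℕ) (Q : Finset (Idx k) × Finset (Idx k) → Prop) :
    Finset (Finset (Idx k) × Finset (Idx k)) :=
  Finset.univ.filter fun p => p.1.card + p.2.card = r ∧ p.2.card = b ∧ Q p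

/-- Sum of values over `PS`. -/
def SS (k r b : ℕ) (Q : Finset (Idx k) × Finset (Idx k) → Prop) : Ak k :=
  ∑ p ∈ PS k r b Q, Tv k p

lemma mem_PS {k r b : ℕ} {Q : Finset (Idx k) × Finset (Idx k) → Prop}
    {p : Finset (Idx k) × Finset (Idx k)} :
    p ∈ PS k r b Q ↔ p.1.card + p.2.card = r ∧ p.2.card = b ∧ Q p := by
  simp [PS]

lemma union_ne_univ {k r : ℕ} (hrk : r ≤ k) (A B : Finset (Idx k)) (h : A.card + B.card = r) :
    A ∪ B ≠ Finset.univ := by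
  intro e
  have h1 := Finset.card_union_le A B
  rw [e, Finset.card_univ, ZMod.card] at h1
  omega

lemma SS_congr (k r b : ℕ) (Q Q' : Finset (Idx k) × Finset (Idx k) → Prop)
    (h : ∀ p : Finset (Idx k) × Finset (Idx k), p.1.card + p.2.card = r → (Q p ↔ Q' p)) :
    SS k r b Q = SS k r b Q' := by
  unfold SS
  congr 1
  ext p
  rw [mem_PS, mem_PS]
  constructor
  · rintro ⟨h1, h2, h3⟩
    exact ⟨h1, h2, (h p h1).mp h3⟩
  · rintro ⟨h1, h2, h3⟩
    exact ⟨h1, h2, (h p h1).mpr h3⟩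

lemma SS_or (k r b : ℕ) (Q Q' : Finset (Idx k) × Finset (Idx k) → Prop)
    (h : ∀ p, Q p → ¬ Q' p) :
    SS k r b (fun p => Q p ∨ Q' p) = SS k r b Q + SS k r b Q' := by
  unfold SS
  rw [← Finset.sum_union]
  · congr 1
    ext p
    rw [Finset.mem_union, mem_PS, mem_PS, mem_PS]
    tauto
  · rw [Finset.disjoint_left]
    intro p h1 h2
    exact h p (mem_PS.mp h1).2.2 (mem_PS.mp h2).2.2

lemma SS_zero (k r b : ℕ) (Q : Finset (Idx k) × Finset (Idx k) → Prop)
    (h : ∀ p : Finset (Idx k) × Finset (Idx k), p.1.card + p.2.card = r → p.2.card = b → ¬ Q p) :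
    SS k r b Q = 0 := by
  unfold SS
  apply Finset.sum_eq_zero
  intro p hp
  rw [mem_PS] at hp
  exact absurd hp.2.2 (h p hp.1 hp.2.1)

lemma union_move {k : ℕ} (A B : Finset (Idx k)) (c : Idx k) (hc : c ∈ A) :
    A.erase c ∪ insert c B = A ∪ B := by
  ext x
  simp only [Finset.mem_union, Finset.mem_erase, Finset.mem_insert]
  by_cases h : x = c
  · simp [h, hc]
  · simp [h]

lemma union_move' {k : ℕ} (A B : Finset (Idx k)) (c : Idx k) (hc : c ∈ B) :
    insert c A ∪ B.erase c = A ∪ B := by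
  rw [Finset.union_comm, union_move B A c hc, Finset.union_comm]

lemma SS_move (k r b : ℕ) (hrk : r ≤ k) (c : Finset (Idx k) → Idx k)
    (Q1 Q2 : Finset (Idx k) × Finset (Idx k) → Prop)
    (h1 : ∀ A B : Finset (Idx k), A.card + B.card = r → Q1 (A, B) →
      c (A ∪ B) ∈ A ∧ c (A ∪ B) ∉ B ∧ c (A ∪ B) - 1 ∉ A ∪ B ∧
        Q2 (A.erase (c (A ∪ B)), insert (c (A ∪ B)) B))
    (h2 : ∀ A B : Finset (Idx k), A.card + B.card = r → Q2 (A, B) →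
      c (A ∪ B) ∈ B ∧ c (A ∪ B) ∉ A ∧
        Q1 (insert (c (A ∪ B)) A, B.erase (c (A ∪ B)))) :
    SS k r b Q1 = SS k r (b + 1) Q2 := by
  unfold SS
  refine Finset.sum_nbij'
    (fun p => (p.1.erase (c (p.1 ∪ p.2)), insert (c (p.1 ∪ p.2)) p.2))
    (fun p => (insert (c (p.1 ∪ p.2)) p.1, p.2.erase (c (p.1 ∪ p.2)))) ?_ ?_ ?_ ?_ ?_
  · rintro ⟨A, B⟩ hp
    rw [mem_PS] at hp ⊢
    obtain ⟨e1, e2, hQ⟩ := hp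
    obtain ⟨ha, hb, -, hQ'⟩ := h1 A B e1 hQ
    refine ⟨?_, ?_, hQ'⟩
    · have := Finset.card_erase_add_one ha
      have := Finset.card_insert_of_notMem hb
      simp only at *
      omega
    · have := Finset.card_insert_of_notMem hb
      simp only at *
      omega
  · rintro ⟨A, B⟩ hp
    rw [mem_PS] at hp ⊢
    obtain ⟨e1, e2, hQ⟩ := hp
    obtain ⟨hb, ha, hQ'⟩ := h2 A B e1 hQ
    refine ⟨?_, ?_, hQ'⟩
    · have := Finset.card_erase_add_one hb
      have := Finset.card_insert_of_notMem ha
      simp only at *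
      omega
    · have := Finset.card_erase_add_one hb
      simp only at *
      omega
  · rintro ⟨A, B⟩ hp
    rw [mem_PS] at hp
    obtain ⟨e1, e2, hQ⟩ := hp
    obtain ⟨ha, hb, -, hQ'⟩ := h1 A B e1 hQ
    simp only [union_move A B _ ha]
    rw [Finset.insert_erase ha, Finset.erase_insert hb]
  · rintro ⟨A, B⟩ hp
    rw [mem_PS] at hp
    obtain ⟨e1, e2, hQ⟩ := hp
    obtain ⟨hb, ha, hQ'⟩ := h2 A B e1 hQ
    simp only [union_move' A B _ hb]
    rw [Finset.insert_erase hb, Finset.erase_insert ha]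
  · rintro ⟨A, B⟩ hp
    rw [mem_PS] at hp
    obtain ⟨e1, e2, hQ⟩ := hp
    obtain ⟨ha, hb, hc, hQ'⟩ := h1 A B e1 hQ
    exact Tv_move k A B (union_ne_univ hrk A B e1) _ ha hb hc

/-- Type V pairs. -/
def HV (k : ℕ) (p : Finset (Idx k) × Finset (Idx k)) : Prop :=
  mn k (p.1 ∪ p.2) ∈ p.2 ∧ mn k (p.1 ∪ p.2) ∉ p.1

/-- Pairs whose minimum is on the left only. -/
def HV' (k : ℕ) (p : Finset (Idx k) × Finset (Idx k)) : Prop :=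
  mn k (p.1 ∪ p.2) ∈ p.1 ∧ mn k (p.1 ∪ p.2) ∉ p.2

/-- Type U pairs. -/
def HU (k : ℕ) (p : Finset (Idx k) × Finset (Idx k)) : Prop :=
  mn k (p.1 ∪ p.2) ∈ p.1 ∧ mn k (p.1 ∪ p.2) ∈ p.2

/-- `u_min` exists and is on the left only. -/
def PL (k : ℕ) (p : Finset (Idx k) × Finset (Idx k)) : Prop :=
  (candS k (p.1 ∪ p.2)).Nonempty ∧ uminS k (p.1 ∪ p.2) ∈ p.1 ∧ uminS k (p.1 ∪ p.2) ∉ p.2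

/-- `u_min` exists and is on the right only. -/
def PR (k : ℕ) (p : Finset (Idx k) × Finset (Idx k)) : Prop :=
  (candS k (p.1 ∪ p.2)).Nonempty ∧ uminS k (p.1 ∪ p.2) ∈ p.2 ∧ uminS k (p.1 ∪ p.2) ∉ p.1

/-- Weak connected pairs. -/
def PW (k : ℕ) (p : Finset (Idx k) × Finset (Idx k)) : Prop := ¬ PL k p ∧ ¬ PR k p

lemma SS_V' (k r b : ℕ) (hrk : r ≤ k) : SS k r b (HV' k) = SS k r (b + 1) (HV k) := by
  apply SS_move k r b hrk (mn k)
  · intro A B e h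
    obtain ⟨h1, h2⟩ := h
    simp only at h1 h2
    refine ⟨h1, h2, mn_pred k _ (union_ne_univ hrk A B e), ?_⟩
    unfold HV
    simp only [union_move A B _ h1]
    simp
  · intro A B e h
    obtain ⟨h1, h2⟩ := h
    simp only at h1 h2
    refine ⟨h1, h2, ?_⟩
    unfold HV'
    simp only [union_move' A B _ h1]
    simp

lemma SS_LR (k r b : ℕ) (hrk : r ≤ k) (Q : Finset (Idx k) × Finset (Idx k) → Prop)
    (hQ : ∀ A B A' B' : Finset (Idx k), A ∪ B = A' ∪ B' → (mn k (A ∪ B) ∈ A ↔ mn k (A ∪ B) ∈ A') →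
      (mn k (A ∪ B) ∈ B ↔ mn k (A ∪ B) ∈ B') → Q (A, B) → Q (A', B')) :
    SS k r b (fun p => Q p ∧ PL k p) = SS k r (b + 1) (fun p => Q p ∧ PR k p) := by
  apply SS_move k r b hrk (uminS k)
  · intro A B e h
    obtain ⟨hq, h0, h1, h2⟩ := h
    simp only at h0 h1 h2
    have hne := uminS_ne k _ h0
    refine ⟨h1, h2, uminS_pred k _ (union_ne_univ hrk A B e) h0, ?_, ?_⟩
    · refine hQ A B _ _ (union_move A B _ h1).symm ?_ ?_ hq
      · simp [hne.symm]
      · simp [hne.symm]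
    · unfold PR
      simp only [union_move A B _ h1]
      simp [h0]
  · intro A B e h
    obtain ⟨hq, h0, h1, h2⟩ := h
    simp only at h0 h1 h2
    have hne := uminS_ne k _ h0
    refine ⟨h1, h2, ?_, ?_⟩
    · refine hQ A B _ _ (union_move' A B _ h1).symm ?_ ?_ hq
      · simp [hne.symm]
      · simp [hne.symm]
    · unfold PL
      simp only [union_move' A B _ h1]
      simp [h0]

lemma SS_VLR (k r b : ℕ) (hrk : r ≤ k) :
    SS k r b (fun p => HV k p ∧ PL k p) = SS k r (b + 1) (fun p => HV k p ∧ PR k p) := by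
  apply SS_LR k r b hrk
  intro A B A' B' h h1 h2 h3
  unfold HV at *
  simp only at *
  rw [← h, ← h1, ← h2]
  exact h3

lemma SS_ULR (k r b : ℕ) (hrk : r ≤ k) :
    SS k r b (fun p => HU k p ∧ PL k p) = SS k r (b + 1) (fun p => HU k p ∧ PR k p) := by
  apply SS_LR k r b hrk
  intro A B A' B' h h1 h2 h3
  unfold HU at *
  simp only at *
  rw [← h, ← h1, ← h2]
  exact h3

lemma SS_split (k r b : ℕ) (Q : Finset (Idx k) × Finset (Idx k) → Prop) :
    SS k r b Q = SS k r b (fun p => Q p ∧ PW k p) + SS k r b (fun p => Q p ∧ PL k p)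
      + SS k r b (fun p => Q p ∧ PR k p) := by
  rw [← SS_or, ← SS_or]
  · apply SS_congr
    intro p _
    unfold PW
    tauto
  · rintro p (⟨-, h⟩ | ⟨-, h⟩) ⟨-, h'⟩
    · exact h.2 h'
    · exact h'.2.2 h.2.1
  · rintro p ⟨-, h⟩ ⟨-, h'⟩
    exact h.1 h'

lemma he_eq (k r b : ℕ) (hr1 : 1 ≤ r) (hrk : r ≤ k) (hb : b ≤ r) :
    hFun k (r - b) * eFun k b =
      SS k r b (HV k) + SS k r (b + 1) (HV k) + SS k r b (HU k) := by
  rw [← SS_V' k r b hrk, ← SS_or, ← SS_or]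
  · unfold hFun eFun SS
    rw [Finset.sum_mul_sum, ← Finset.sum_product']
    apply Finset.sum_congr
    · ext ⟨A, B⟩
      rw [mem_PS]
      simp only [Finset.mem_product, Finset.mem_powersetCard, Finset.subset_univ, true_and]
      constructor
      · rintro ⟨h1, h2⟩
        have h3 : A.card + B.card = r := by omega
        refine ⟨h3, h2, ?_⟩
        have hne : (A ∪ B).Nonempty := by
          rw [Finset.nonempty_iff_ne_empty]
          intro e
          rw [Finset.union_eq_empty] at e
          rw [e.1, e.2] at h3
          simp at h3
          omega
        have := Finset.mem_union.mp (mn_mem k _ hne)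
        unfold HV HV' HU
        simp only
        tauto
      · rintro ⟨h1, h2, -⟩
        omega
    · rintro ⟨A, B⟩ _
      rfl
  · rintro p (⟨-, h⟩ | ⟨-, h⟩) ⟨h1, h2⟩
    · exact h h1
    · exact h h2
  · rintro p ⟨h, -⟩ ⟨-, h'⟩
    exact h' h

/-- The word attached to a pair. -/
def Wd (k : ℕ) (p : Finset (Idx k) × Finset (Idx k)) : Word k :=
  (srt k (p.1 ∪ p.2) p.1).reverse ++ srt k (p.1 ∪ p.2) p.2

lemma supp_Wd (k : ℕ) (p : Finset (Idx k) × Finset (Idx k)) : supp k (Wd k p) = p.1 ∪ p.2 := by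
  ext x
  simp [supp, Wd, mem_srt]

lemma length_Wd (k : ℕ) (p : Finset (Idx k) × Finset (Idx k)) :
    (Wd k p).length = p.1.card + p.2.card := by
  simp [Wd, srt_length]

lemma Aword_Wd (k : ℕ) (p : Finset (Idx k) × Finset (Idx k)) (h : p.1 ∪ p.2 ≠ Finset.univ) :
    Aword k (Wd k p) = Tv k p := by
  unfold Wd Tv
  rw [Aword_append, Aword_srt_dec k _ _ h Finset.subset_union_left,
    Aword_srt_inc k _ _ h Finset.subset_union_right]

lemma count_srt (k : ℕ) (S A : Finset (Idx k)) (x : Idx k) :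
    (srt k S A).count x = if x ∈ A then 1 else 0 := by
  rw [(srt_nodup k S A).count]
  simp [mem_srt]

lemma count_Wd (k : ℕ) (p : Finset (Idx k) × Finset (Idx k)) (x : Idx k) :
    (Wd k p).count x = (if x ∈ p.1 then 1 else 0) + (if x ∈ p.2 then 1 else 0) := by
  unfold Wd
  rw [List.count_append, List.count_reverse, count_srt, count_srt]

lemma wc_Wd (k : ℕ) (p : Finset (Idx k) × Finset (Idx k)) :
    IsWeakConnected k (Wd k p) ↔ PW k p := by
  unfold IsWeakConnected uminCount PW PL PR
  rw [cands_eq, umin_eq, supp_Wd, count_Wd]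
  by_cases h : (candS k (p.1 ∪ p.2)).Nonempty
  · have := Finset.mem_union.mp (uminS_mem k _ h)
    by_cases h1 : uminS k (p.1 ∪ p.2) ∈ p.1 <;> by_cases h2 : uminS k (p.1 ∪ p.2) ∈ p.2 <;>
      simp_all
  · simp [h]

/-- Ascents of a list. -/
def ascL (l : List ℕ) : ℕ := (l.zip l.tail).countP fun p => decide (p.1 < p.2)

lemma asc_eq (k : ℕ) (u : Word k) : asc k u = ascL (posList k u) := rfl

lemma ascL_cons (x y : ℕ) (t : List ℕ) :
    ascL (x :: y :: t) = ascL (y :: t) + if x < y then 1 else 0 := by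
  unfold ascL
  simp [List.countP_cons]

lemma ascL_inc (as : List ℕ) : ∀ v, (v :: as).Pairwise (· < ·) → ascL (v :: as) = as.length := by
  induction as with
  | nil => intro v _; simp [ascL]
  | cons a t ih =>
    intro v h
    rw [List.pairwise_cons] at h
    rw [ascL_cons, ih a h.2, if_pos (h.1 a List.mem_cons_self)]
    rfl

lemma ascL_app (w : List ℕ) (v : ℕ) (ds : List ℕ) (h : (ds ++ [v]).Pairwise (· > ·)) :
    ascL (ds ++ v :: w) = ascL (v :: w) := by
  induction ds with
  | nil => rfl
  | cons d t ih =>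
    rw [List.cons_append, List.pairwise_cons] at h
    rw [← ih h.2]
    cases t with
    | nil =>
      have := h.1 v (by simp)
      simp only [List.nil_append, List.cons_append]
      rw [ascL_cons, if_neg (by omega)]
      rfl
    | cons e t =>
      have := h.1 e (by simp)
      simp only [List.cons_append]
      rw [ascL_cons, if_neg (by omega)]
      rfl

lemma chain_gt (l : List ℕ) : List.Chain' (· > ·) l ↔ l.Pairwise (· > ·) :=
  List.isChain_iff_pairwise

lemma chain_lt (l : List ℕ) : List.Chain' (· < ·) l ↔ l.Pairwise (· < ·) :=
  List.isChain_iff_pairwise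

lemma posList_Wd (k : ℕ) (p : Finset (Idx k) × Finset (Idx k)) :
    posList k (Wd k p) = ((srt k (p.1 ∪ p.2) p.1).map (pos k (p.1 ∪ p.2))).reverse ++
      (srt k (p.1 ∪ p.2) p.2).map (pos k (p.1 ∪ p.2)) := by
  unfold posList
  rw [supp_Wd]
  unfold Wd
  rw [List.map_append, List.map_reverse]

lemma srt_map_pw (k : ℕ) (S A : Finset (Idx k)) :
    ((srt k S A).map (pos k S)).Pairwise (· < ·) := by
  rw [List.pairwise_map]
  exact srt_pw k S A

/-- A sorted list containing the minimum starts with it. -/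
lemma srt_head (k : ℕ) (S A : Finset (Idx k)) (hA : A ⊆ S) (h : mn k S ∈ A) :
    ∃ t, (srt k S A).map (pos k S) = pos k S (mn k S) :: t := by
  have hm : mn k S ∈ srt k S A := (mem_srt _ _ _ _).mpr h
  have hp := srt_pw k S A
  have hmem : ∀ x ∈ srt k S A, x ∈ S := fun x hx => hA ((mem_srt _ _ _ _).mp hx)
  cases hs : srt k S A with
  | nil => rw [hs] at hm; simp at hm
  | cons a t =>
    rw [hs] at hm hp hmem
    refine ⟨t.map (pos k S), ?_⟩
    rw [List.map_cons]
    congr 1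
    rw [List.pairwise_cons] at hp
    have h1 := mn_le k S a (hmem a List.mem_cons_self)
    rcases List.mem_cons.mp hm with e | e
    · rw [e]
    · have := hp.1 _ e
      omega

lemma hookV_Wd (k : ℕ) (p : Finset (Idx k) × Finset (Idx k)) (hS : p.1 ∪ p.2 ≠ Finset.univ)
    (h : HV k p) : IsHookV k (Wd k p) ∧ asc k (Wd k p) + 1 = p.2.card := by
  obtain ⟨h1, h2⟩ := h
  obtain ⟨t, ht⟩ := srt_head k (p.1 ∪ p.2) p.2 Finset.subset_union_right h1
  have e := posList_Wd k p
  rw [ht] at e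
  have hp1 : (((srt k (p.1 ∪ p.2) p.1).map (pos k (p.1 ∪ p.2))).reverse ++
      [pos k (p.1 ∪ p.2) (mn k (p.1 ∪ p.2))]).Pairwise (· > ·) := by
    rw [List.pairwise_append]
    refine ⟨List.pairwise_reverse.mpr (srt_map_pw _ _ _), List.pairwise_singleton _ _, ?_⟩
    intro a ha b hb
    rw [List.mem_singleton] at hb
    rw [List.mem_reverse, List.mem_map] at ha
    obtain ⟨x, hx, rfl⟩ := ha
    rw [mem_srt] at hx
    subst hb
    have hle := mn_le k (p.1 ∪ p.2) x (Finset.mem_union_left _ hx)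
    refine lt_of_le_of_ne hle ?_
    intro e
    apply h2
    rw [pos_inj _ _ e]
    exact hx
  have hp2 := srt_map_pw k (p.1 ∪ p.2) p.2
  have hl : ((srt k (p.1 ∪ p.2) p.2).map (pos k (p.1 ∪ p.2))).length = p.2.card := by
    rw [List.length_map, srt_length]
  rw [ht] at hp2 hl
  refine ⟨⟨by rw [supp_Wd]; exact hS, _, _, _, e, (chain_gt _).mpr hp1, (chain_lt _).mpr hp2⟩, ?_⟩
  rw [asc_eq, e, ascL_app _ _ _ hp1, ascL_inc _ _ hp2]
  exact hl

lemma hookU_Wd (k : ℕ) (p : Finset (Idx k) × Finset (Idx k)) (hS : p.1 ∪ p.2 ≠ Finset.univ)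
    (h : HU k p) : IsHookU k (Wd k p) ∧ asc k (Wd k p) + 1 = p.2.card := by
  obtain ⟨h1, h2⟩ := h
  obtain ⟨s, hs⟩ := srt_head k (p.1 ∪ p.2) p.1 Finset.subset_union_left h1
  obtain ⟨t, ht⟩ := srt_head k (p.1 ∪ p.2) p.2 Finset.subset_union_right h2
  have e := posList_Wd k p
  rw [ht, hs, List.reverse_cons, List.append_assoc, List.singleton_append] at e
  have hp1 := srt_map_pw k (p.1 ∪ p.2) p.1
  rw [hs] at hp1
  replace hp1 := List.pairwise_reverse.mpr hp1
  rw [List.reverse_cons] at hp1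
  have hp2 := srt_map_pw k (p.1 ∪ p.2) p.2
  have hl : ((srt k (p.1 ∪ p.2) p.2).map (pos k (p.1 ∪ p.2))).length = p.2.card := by
    rw [List.length_map, srt_length]
  rw [ht] at hp2 hl
  refine ⟨⟨by rw [supp_Wd]; exact hS, _, _, _, e, (chain_gt _).mpr hp1, (chain_lt _).mpr hp2⟩, ?_⟩
  rw [asc_eq, e, ascL_app _ _ _ hp1, ascL_cons, if_neg (lt_irrefl _), ascL_inc _ _ hp2]
  exact hl

lemma split_Wd (k : ℕ) (u : Word k) (l1 l2 : List ℕ) (h : posList k u = l1 ++ l2)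
    (h1 : l1.Pairwise (· > ·)) (h2 : l2.Pairwise (· < ·)) :
    ∃ p : Finset (Idx k) × Finset (Idx k), Wd k p = u ∧ p.1 ∪ p.2 = supp k u ∧
      (∀ x, x ∈ p.1 ↔ pos k (supp k u) x ∈ l1) ∧ (∀ x, x ∈ p.2 ↔ pos k (supp k u) x ∈ l2) := by
  unfold posList at h
  obtain ⟨u1, u2, hu, rfl, rfl⟩ := List.map_eq_append_iff.mp h
  have hsu : u1.toFinset ∪ u2.toFinset = supp k u := by
    rw [hu]; simp [supp]
  refine ⟨(u1.toFinset, u2.toFinset), ?_, hsu, ?_, ?_⟩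
  · unfold Wd
    simp only
    rw [hsu]
    rw [List.pairwise_map] at h1 h2
    rw [← srt_unique k (supp k u) u1.toFinset u1.reverse (List.pairwise_reverse.mpr h1)
      (by intro x; simp),
      ← srt_unique k (supp k u) u2.toFinset u2 h2 (by intro x; simp), List.reverse_reverse, hu]
  · intro x
    rw [List.mem_map_of_injective (pos_inj k _)]
    simp
  · intro x
    rw [List.mem_map_of_injective (pos_inj k _)]
    simp

lemma exists_of_hookV (k : ℕ) (u : Word k) (h : IsHookV k u) :
    ∃ p : Finset (Idx k) × Finset (Idx k), Wd k p = u ∧ HV k p := by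
  obtain ⟨-, ds, as, v, e, h1, h2⟩ := h
  rw [chain_gt, List.pairwise_append] at h1
  rw [chain_lt] at h2
  obtain ⟨p, hp, hs, hA, hB⟩ := split_Wd k u ds (v :: as) e h1.1 h2
  refine ⟨p, hp, ?_⟩
  have hv : v ∈ posList k u := by rw [e]; simp
  unfold posList at hv
  obtain ⟨x, hx, rfl⟩ := List.mem_map.mp hv
  have hxm : mn k (p.1 ∪ p.2) = x := by
    rw [hs]
    apply mn_eq
    · simpa [supp] using hx
    · intro y hy
      rw [← hs, Finset.mem_union, hA, hB] at hy
      rw [List.pairwise_cons] at h2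
      rcases hy with hy | hy
      · exact le_of_lt (h1.2.2 _ hy _ (by simp))
      · rcases List.mem_cons.mp hy with e | e
        · exact le_of_eq e.symm
        · exact le_of_lt (h2.1 _ e)
  unfold HV
  rw [hxm, hA, hB]
  refine ⟨List.mem_cons_self, fun hc => ?_⟩
  exact lt_irrefl _ (h1.2.2 _ hc _ (List.mem_singleton_self _))

lemma exists_of_hookU (k : ℕ) (u : Word k) (h : IsHookU k u) :
    ∃ p : Finset (Idx k) × Finset (Idx k), Wd k p = u ∧ HU k p := by
  obtain ⟨-, ds, as, v, e, h1, h2⟩ := h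
  rw [chain_gt] at h1
  rw [chain_lt] at h2
  have e' : posList k u = (ds ++ [v]) ++ (v :: as) := by rw [e]; simp
  obtain ⟨p, hp, hs, hA, hB⟩ := split_Wd k u (ds ++ [v]) (v :: as) e' h1 h2
  rw [List.pairwise_append] at h1
  refine ⟨p, hp, ?_⟩
  have hv : v ∈ posList k u := by rw [e]; simp
  unfold posList at hv
  obtain ⟨x, hx, rfl⟩ := List.mem_map.mp hv
  have hxm : mn k (p.1 ∪ p.2) = x := by
    rw [hs]
    apply mn_eq
    · simpa [supp] using hx
    · intro y hy
      rw [← hs, Finset.mem_union, hA, hB] at hy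
      rw [List.pairwise_cons] at h2
      rcases hy with hy | hy
      · rcases List.mem_append.mp hy with hy | hy
        · exact le_of_lt (h1.2.2 _ hy _ (by simp))
        · exact le_of_eq (List.mem_singleton.mp hy).symm
      · rcases List.mem_cons.mp hy with e | e
        · exact le_of_eq e.symm
        · exact le_of_lt (h2.1 _ e)
  unfold HU
  rw [hxm, hA, hB]
  exact ⟨by simp, by simp⟩

lemma left_Wd (k : ℕ) (p : Finset (Idx k) × Finset (Idx k)) (h : HU k p)  (c : Idx k) :
    OnLeftSide k (Wd k p) c ↔ c ∈ p.1 := by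
  unfold OnLeftSide
  rw [supp_Wd]
  constructor
  · rintro ⟨a, b, hab, hch, hc⟩
    have hpw : a.Pairwise (fun x y => pos k (p.1 ∪ p.2) y < pos k (p.1 ∪ p.2) x) := by
      have : (a.map (pos k (p.1 ∪ p.2))).IsChain (· > ·) := by
        rw [List.isChain_map]
        exact hch
      rw [List.isChain_iff_pairwise, List.pairwise_map] at this
      exact this
    unfold Wd at hab
    rcases List.append_eq_append_iff.mp hab with ⟨a', h1, h2⟩ | ⟨c', h1, h2⟩
    · subst h1
      rcases List.mem_append.mp hc with hc | hc
      · rwa [List.mem_reverse, mem_srt] at hc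
      · exfalso
        rw [List.pairwise_append] at hpw
        have h3 := hpw.2.2 (mn k (p.1 ∪ p.2)) (by rw [List.mem_reverse, mem_srt]; exact h.1) c hc
        have h4 : c ∈ p.2 := by
          rw [← mem_srt k (p.1 ∪ p.2), h2]
          exact List.mem_append_left _ hc
        have h5 := mn_le k (p.1 ∪ p.2) c (Finset.mem_union_right _ h4)
        omega
    · have : c ∈ (srt k (p.1 ∪ p.2) p.1).reverse := by
        rw [h1]; exact List.mem_append_left _ hc
      rwa [List.mem_reverse, mem_srt] at this
  · intro hc
    refine ⟨_, _, rfl, ?_, ?_⟩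
    · exact List.Pairwise.isChain (List.pairwise_reverse.mpr (srt_pw k _ _))
    · rw [List.mem_reverse, mem_srt]
      exact hc

lemma finsum_Wd (k r b : ℕ) (hrk : r ≤ k) (Q : Finset (Idx k) × Finset (Idx k) → Prop)
    (X : Set (Word k))
    (h1 : ∀ p : Finset (Idx k) × Finset (Idx k), p.1.card + p.2.card = r → p.2.card = b → Q p →
      Wd k p ∈ X)
    (h2 : ∀ u ∈ X, ∃ p : Finset (Idx k) × Finset (Idx k), Wd k p = u ∧
      p.1.card + p.2.card = r ∧ p.2.card = b ∧ Q p) :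
    ∑ᶠ u ∈ X, Aword k u = SS k r b Q := by
  unfold SS
  rw [← finsum_mem_coe_finset]
  symm
  refine finsum_mem_eq_of_bijOn (Wd k) ⟨?_, ?_, ?_⟩ ?_
  · intro p hp
    rw [Finset.mem_coe, mem_PS] at hp
    exact h1 p hp.1 hp.2.1 hp.2.2
  · intro p hp q hq e
    rw [Finset.mem_coe, mem_PS] at hp hq
    have hs : p.1 ∪ p.2 = q.1 ∪ q.2 := by rw [← supp_Wd, e, supp_Wd]
    unfold Wd at e
    rw [hs] at e
    obtain ⟨e1, e2⟩ := List.append_inj e (by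
      rw [List.length_reverse, List.length_reverse, srt_length, srt_length]; omega)
    rw [List.reverse_inj] at e1
    apply Prod.ext
    · ext x
      rw [← mem_srt k (q.1 ∪ q.2), e1, mem_srt]
    · ext x
      rw [← mem_srt k (q.1 ∪ q.2), e2, mem_srt]
  · intro u hu
    obtain ⟨p, hp, hQ⟩ := h2 u hu
    exact ⟨p, by rw [Finset.mem_coe, mem_PS]; exact hQ, hp⟩
  · intro p hp
    rw [Finset.mem_coe, mem_PS] at hp
    exact (Aword_Wd k p (union_ne_univ hrk _ _ hp.1)).symm

lemma finsum_VWC (k r i : ℕ) (hrk : r ≤ k) :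
    ∑ᶠ u ∈ VSetWC k r (i : ℤ), Aword k u = SS k r (i + 1) (fun p => HV k p ∧ PW k p) := by
  apply finsum_Wd k r (i + 1) hrk
  · rintro p e1 e2 ⟨h, hw⟩
    obtain ⟨h1, h2⟩ := hookV_Wd k p (union_ne_univ hrk _ _ e1) h
    exact ⟨⟨h1, by rw [length_Wd, e1], by omega⟩, (wc_Wd k p).mpr hw⟩
  · rintro u ⟨⟨h1, h2, h3⟩, hw⟩
    obtain ⟨p, rfl, hp⟩ := exists_of_hookV k u h1
    rw [length_Wd] at h2
    obtain ⟨-, h4⟩ := hookV_Wd k p (union_ne_univ hrk _ _ h2) hp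
    exact ⟨p, rfl, h2, by omega, hp, (wc_Wd k p).mp hw⟩

lemma finsum_UWC (k r i : ℕ) (hrk : r ≤ k) :
    ∑ᶠ u ∈ USetWC k r ((i : ℤ) - 1), Aword k u = SS k r i (fun p => HU k p ∧ PW k p) := by
  apply finsum_Wd k r i hrk
  · rintro p e1 e2 ⟨h, hw⟩
    obtain ⟨h1, h2⟩ := hookU_Wd k p (union_ne_univ hrk _ _ e1) h
    exact ⟨⟨h1, by rw [length_Wd, e1], by omega⟩, (wc_Wd k p).mpr hw⟩
  · rintro u ⟨⟨h1, h2, h3⟩, hw⟩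
    obtain ⟨p, rfl, hp⟩ := exists_of_hookU k u h1
    rw [length_Wd] at h2
    obtain ⟨-, h4⟩ := hookU_Wd k p (union_ne_univ hrk _ _ h2) hp
    exact ⟨p, rfl, h2, by omega, hp, (wc_Wd k p).mp hw⟩

lemma finsum_UNWCL (k r i : ℕ) (hrk : r ≤ k) :
    ∑ᶠ u ∈ USetNWCL k r ((i : ℤ) - 1), Aword k u = SS k r i (fun p => HU k p ∧ PL k p) := by
  apply finsum_Wd k r i hrk
  · rintro p e1 e2 ⟨h, hw⟩
    obtain ⟨h1, h2⟩ := hookU_Wd k p (union_ne_univ hrk _ _ e1) h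
    refine ⟨⟨h1, by rw [length_Wd, e1], by omega⟩, ?_, ?_⟩
    · rw [wc_Wd]
      exact fun hc => hc.1 hw
    · rw [left_Wd k p h, umin_eq, supp_Wd]
      exact hw.2.1
  · rintro u ⟨⟨h1, h2, h3⟩, hw, hl⟩
    obtain ⟨p, rfl, hp⟩ := exists_of_hookU k u h1
    rw [length_Wd] at h2
    obtain ⟨-, h4⟩ := hookU_Wd k p (union_ne_univ hrk _ _ h2) hp
    refine ⟨p, rfl, h2, by omega, hp, ?_⟩
    rw [left_Wd k p hp, umin_eq, supp_Wd] at hl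
    rw [wc_Wd] at hw
    by_contra hc
    apply hw
    refine ⟨hc, fun hr => hr.2.2 hl⟩

lemma sum_s {M : Type*} [AddCommGroup M] (V U : ℕ → M) (hV : V 0 = 0) (n : ℕ) :
    (∑ j ∈ Finset.range (n + 1), ((-1 : ℤ) ^ j) • (V (n - j) + V (n - j + 1) + U (n - j))) =
      V (n + 1) + ((-1 : ℤ) ^ n) • ∑ b ∈ Finset.range (n + 1), ((-1 : ℤ) ^ b) • U b := by
  induction n with
  | zero => simp [hV]
  | succ n ih =>
    rw [Finset.sum_range_succ']
    simp only [Nat.add_sub_add_right, pow_succ, mul_smul, neg_smul, one_smul, smul_neg,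
      Finset.sum_neg_distrib] at ih ⊢
    rw [ih, Finset.sum_range_succ _ (n + 1)]
    simp only [pow_zero, one_smul, Nat.sub_zero, smul_add, neg_add, pow_succ, mul_smul, neg_smul,
      smul_neg, neg_neg, smul_smul, ← mul_pow]
    simp
    abel

lemma sum_p {M : Type*} [AddCommGroup M] (U : ℕ → M) (n : ℕ) :
    (∑ i ∈ Finset.range n, ∑ b ∈ Finset.range (i + 1), ((-1 : ℤ) ^ b) • U b) =
      ∑ b ∈ Finset.range n, ((-1 : ℤ) ^ b * ((n : ℤ) - b)) • U b := by
  induction n with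
  | zero => simp
  | succ n ih =>
    have : ∀ b : ℕ, ((-1 : ℤ) ^ b * (((n + 1 : ℕ) : ℤ) - b)) • U b =
        ((-1 : ℤ) ^ b * ((n : ℤ) - b)) • U b + ((-1 : ℤ) ^ b) • U b := by
      intro b
      rw [← add_smul]
      congr 1
      push_cast
      ring
    rw [Finset.sum_range_succ, ih]
    simp only [this]
    rw [Finset.sum_add_distrib]
    congr 1
    rw [Finset.sum_range_succ, sub_self, mul_zero, zero_smul, add_zero]

lemma sum_V {M : Type*} [AddCommGroup M] (L R : ℕ → M) (h0 : L 0 = 0)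
    (h : ∀ b, L b = R (b + 1)) (n : ℕ) :
    (∑ i ∈ Finset.range n, ((-1 : ℤ) ^ i) • (L (i + 1) + R (i + 1))) = -((-1 : ℤ) ^ n • L n) := by
  induction n with
  | zero => simp [h0]
  | succ n ih =>
    rw [Finset.sum_range_succ, ih, ← h n, pow_succ]
    simp only [mul_neg, mul_one, neg_smul, smul_add]
    abel

lemma sum_U {M : Type*} [AddCommGroup M] (L R : ℕ → M) (hR : R 0 = 0)
    (h : ∀ b, L b = R (b + 1)) (r : ℤ) (n : ℕ) :
    (∑ b ∈ Finset.range (n + 1), ((-1 : ℤ) ^ b * (r - b)) • (L b + R b)) =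
      (∑ b ∈ Finset.range (n + 1), ((-1 : ℤ) ^ b) • L b)
        + ((-1 : ℤ) ^ n * (r - (n + 1 : ℕ))) • L n := by
  induction n with
  | zero =>
    simp [hR]
    rw [sub_smul]
    simp
  | succ n ih =>
    rw [Finset.sum_range_succ, ih, Finset.sum_range_succ _ (n + 1), ← h n]
    push_cast
    have e : ((-1 : ℤ) ^ (n + 1) * (r - (n + 1))) • (L (n + 1) + L n) =
        ((-1 : ℤ) ^ (n + 1)) • L (n + 1) +
          ((-1 : ℤ) ^ (n + 1) * (r - (n + 1 + 1))) • L (n + 1) -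
          ((-1 : ℤ) ^ n * (r - (n + 1))) • L n := by
      rw [← add_smul, smul_add, sub_eq_add_neg (_ • L (n + 1)), ← neg_smul]
      congr 2 <;> ring
    rw [e]
    abel

lemma sum_Icc_range {M : Type*} [AddCommGroup M] (f : ℕ → M) (h0 : f 0 = 0) (n : ℕ) :
    ∑ i ∈ Finset.Icc 1 n, f i = ∑ i ∈ Finset.range (n + 1), f i := by
  rw [Finset.range_eq_Ico, Finset.sum_eq_sum_Ico_succ_bot (by omega), h0, zero_add]
  rfl

lemma sum_main {M : Type*} [AddCommGroup M] (n : ℕ) (V VW VL VR U UW UL UR : ℕ → M)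
    (he : ℕ → ℕ → M) (s : ℕ → M)
    (hs : ∀ i, s i = ∑ j ∈ Finset.range (i + 1), ((-1 : ℤ) ^ j) • he (n + 1 - i + j) (i - j))
    (hhe : ∀ b, b ≤ n + 1 → he (n + 1 - b) b = V b + V (b + 1) + U b)
    (hV : ∀ b, V b = VW b + VL b + VR b) (hU : ∀ b, U b = UW b + UL b + UR b)
    (hVLR : ∀ b, VL b = VR (b + 1)) (hULR : ∀ b, UL b = UR (b + 1))
    (hV0 : V 0 = 0) (hVL0 : VL 0 = 0) (hVLn : VL (n + 1) = 0)
    (hUW0 : UW 0 = 0) (hUL0 : UL 0 = 0) (hUR0 : UR 0 = 0) (hULn : UL n = 0) :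
    ∑ i ∈ Finset.range (n + 1), ((-1 : ℤ) ^ i) • s i =
      (∑ i ∈ Finset.range (n + 1), ((-1 : ℤ) ^ i) • VW (i + 1)) +
      (∑ i ∈ Finset.Icc 1 (n + 1 - 1), ((-1 : ℤ) ^ i * (((n + 1 : ℕ) : ℤ) - i)) • UW i) +
      ∑ i ∈ Finset.Icc 1 (n + 1 - 2), ((-1 : ℤ) ^ i) • UL i := by
  have hp : ∑ i ∈ Finset.range (n + 1), ((-1 : ℤ) ^ i) • s i =
      (∑ i ∈ Finset.range (n + 1), ((-1 : ℤ) ^ i) • V (i + 1)) +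
      ∑ b ∈ Finset.range (n + 1), ((-1 : ℤ) ^ b * (((n + 1 : ℕ) : ℤ) - b)) • U b := by
    rw [← sum_p, ← Finset.sum_add_distrib]
    apply Finset.sum_congr rfl
    intro i hi
    rw [Finset.mem_range] at hi
    have hs' : s i = V (i + 1) +
        ((-1 : ℤ) ^ i) • ∑ b ∈ Finset.range (i + 1), ((-1 : ℤ) ^ b) • U b := by
      rw [← sum_s V U hV0, hs]
      apply Finset.sum_congr rfl
      intro j hj
      rw [Finset.mem_range] at hj
      rw [← hhe (i - j) (by omega)]
      congr 2
      omega
    rw [hs', smul_add, smul_smul, ← mul_pow]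
    simp
  have hV' := sum_V VL VR hVL0 hVLR (n + 1)
  have hU' := sum_U UL UR hUR0 hULR ((n + 1 : ℕ) : ℤ) n
  have e1 : ∀ i, ((-1 : ℤ) ^ i) • V (i + 1) =
      ((-1 : ℤ) ^ i) • VW (i + 1) + ((-1 : ℤ) ^ i) • (VL (i + 1) + VR (i + 1)) := by
    intro i
    rw [← smul_add, ← add_assoc, ← hV]
  have e2 : ∀ b : ℕ, ((-1 : ℤ) ^ b * (((n + 1 : ℕ) : ℤ) - b)) • U b =
      ((-1 : ℤ) ^ b * (((n + 1 : ℕ) : ℤ) - b)) • UW b +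
      ((-1 : ℤ) ^ b * (((n + 1 : ℕ) : ℤ) - b)) • (UL b + UR b) := by
    intro b
    rw [← smul_add, ← add_assoc, ← hU]
  rw [hp]
  simp only [e1, e2]
  rw [Finset.sum_add_distrib, Finset.sum_add_distrib, hV', hU', hVLn, sub_self, mul_zero, zero_smul,
    smul_zero, neg_zero, add_zero, add_zero, ← add_assoc, Nat.add_sub_cancel]
  rw [sum_Icc_range (fun i : ℕ => ((-1 : ℤ) ^ i * (((n + 1 : ℕ) : ℤ) - i)) • UW i)
    (by simp only [hUW0, smul_zero])]
  congr 1
  rw [Finset.sum_range_succ, hULn, smul_zero, add_zero,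
    sum_Icc_range (fun i : ℕ => ((-1 : ℤ) ^ i) • UL i) (by simp only [hUL0, smul_zero])]
  rcases Nat.eq_zero_or_pos n with rfl | hn
  · simp [hUL0]
  · congr 2
    omega

theorem statement7 (k : ℕ) (hk : 1 ≤ k) (r : ℕ) (hr1 : 1 ≤ r) (hrk : r ≤ k) :
    pFun k r =
      (∑ i ∈ Finset.range r, ((-1 : ℤ) ^ i) • ∑ᶠ u ∈ VSetWC k r (i : ℤ), Aword k u) +
      (∑ i ∈ Finset.Icc 1 (r - 1),
        ((-1 : ℤ) ^ i * ((r : ℤ) - i)) • ∑ᶠ u ∈ USetWC k r ((i : ℤ) - 1), Aword k u) +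
      ∑ i ∈ Finset.Icc 1 (r - 2),
        ((-1 : ℤ) ^ i) • ∑ᶠ u ∈ USetNWCL k r ((i : ℤ) - 1), Aword k u := by
  have hV0 : ∀ Q : Finset (Idx k) × Finset (Idx k) → Prop, (∀ p, Q p → HV k p) →
      SS k r 0 Q = 0 := by
    intro Q hQ
    apply SS_zero
    intro p _ h2 h3
    rw [Finset.card_eq_zero] at h2
    have := (hQ p h3).1
    rw [h2] at this
    simp at this
  have hVr : SS k r r (fun p => HV k p ∧ PL k p) = 0 := by
    apply SS_zero
    rintro p h1 h2 ⟨-, h3⟩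
    have h4 : p.1 = ∅ := Finset.card_eq_zero.mp (by omega)
    have := h3.2.1
    rw [h4] at this
    simp at this
  have hU0 : ∀ Q : Finset (Idx k) × Finset (Idx k) → Prop,
      SS k r 0 (fun p => HU k p ∧ Q p) = 0 := by
    intro Q
    apply SS_zero
    rintro p _ h2 ⟨h3, -⟩
    rw [Finset.card_eq_zero] at h2
    have := h3.2
    rw [h2] at this
    simp at this
  obtain ⟨n, rfl⟩ : ∃ n, r = n + 1 := ⟨r - 1, by omega⟩
  have hUn : SS k (n + 1) n (fun p => HU k p ∧ PL k p) = 0 := by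
    apply SS_zero
    rintro p h1 h2 ⟨h3, h4⟩
    have h5 : p.1.card ≤ 1 := by omega
    rw [Finset.card_le_one] at h5
    exact uminS_ne k _ h4.1 (h5 _ h4.2.1 _ h3.1)
  simp only [finsum_VWC k (n + 1) _ hrk, finsum_UWC k (n + 1) _ hrk, finsum_UNWCL k (n + 1) _ hrk]
  exact sum_main n (fun b => SS k (n + 1) b (HV k))
    (fun b => SS k (n + 1) b (fun p => HV k p ∧ PW k p))
    (fun b => SS k (n + 1) b (fun p => HV k p ∧ PL k p))
    (fun b => SS k (n + 1) b (fun p => HV k p ∧ PR k p))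
    (fun b => SS k (n + 1) b (HU k))
    (fun b => SS k (n + 1) b (fun p => HU k p ∧ PW k p))
    (fun b => SS k (n + 1) b (fun p => HU k p ∧ PL k p))
    (fun b => SS k (n + 1) b (fun p => HU k p ∧ PR k p))
    (fun a b => hFun k a * eFun k b) (fun i => sHookFun k (n + 1) i) (fun i => rfl)
    (fun b hb => he_eq k (n + 1) b hr1 hrk hb) (fun b => SS_split _ _ _ _)
    (fun b => SS_split _ _ _ _) (fun b => SS_VLR k _ b hrk) (fun b => SS_ULR k _ b hrk)
    (hV0 _ (fun p h => h)) (hV0 _ (fun p h => h.1)) hVr (hU0 _) (hU0 _) (hU0 _) hUn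

end MN

end
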